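/- arXiv:1907.03620 — 7 statements merged into one kernel-verified Lean document; each statement's English description precedes it below -/
import Mathlib

section
/- Let S be a set of tiles and b ∈ ℤ a border; let L = {t ∈ S | t.1 < b} and R = {t ∈ S | b ≤ t.1}. Define the join relation ρ on S by: s ρ t iff (s, t ∈ L and s and t are reachable in the cluster graph on L), or (s, t ∈ R and s and t are reachable in the cluster graph on R), or (s and t are adjacent tiles with exactly one of them in L and the other in R). Then for all s, t ∈ S, s and t lie in the same cluster of S if and only if the pair (s, t) lies in the equivalence closure (EqvGen) of ρ. In other words, per-slice clusters that have adjacent tiles across the border are joined into exactly the clusters of S, regardless of how many adjacent tile pairs cross that border or on which side of it they lie. -/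
/-- Two tiles of the integer grid are adjacent (Chebyshev distance 1). -/
def TileAdj (t u : ℤ × ℤ) : Prop :=
  t ≠ u ∧ max |t.1 - u.1| |t.2 - u.2| ≤ 1

/-- The cluster graph on a set `S` of tiles: vertices are the tiles of `S`,
edges join adjacent tiles. -/
def clusterGraph (S : Set (ℤ × ℤ)) : SimpleGraph S where
  Adj a b := TileAdj a.1 b.1
  symm := by
    constructor
    rintro a b ⟨hne, hd⟩
    refine ⟨fun h => hne h.symm, ?_⟩
    rw [abs_sub_comm b.1.1, abs_sub_comm b.1.2]
    exact hd
  loopless := by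
    constructor
    rintro a ⟨hne, -⟩
    exact hne rfl

/-- **Theorem 1 (multiple single-border crossings invariant).**
Per-slice clusters (on the left slice `L` and right slice `R` of a border `b`)
that have adjacent tiles across the border are joined into exactly the
clusters of `S`, regardless of how many adjacent tile pairs cross that border
or on which side of it they lie. -/
theorem multiple_single_border_crossings_invariant
    (S : Set (ℤ × ℤ)) (b : ℤ)
    (L R : Set (ℤ × ℤ))
    (hL : L = {t ∈ S | t.1 < b}) (hR : R = {t ∈ S | b ≤ t.1})
    (ρ : S → S → Prop)
    (hρ : ∀ s t : S, ρ s t ↔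
      (∃ (hs : s.1 ∈ L) (ht : t.1 ∈ L),
        (clusterGraph L).Reachable ⟨s.1, hs⟩ ⟨t.1, ht⟩) ∨
      (∃ (hs : s.1 ∈ R) (ht : t.1 ∈ R),
        (clusterGraph R).Reachable ⟨s.1, hs⟩ ⟨t.1, ht⟩) ∨
      (TileAdj s.1 t.1 ∧
        ((s.1 ∈ L ∧ t.1 ∈ R) ∨ (s.1 ∈ R ∧ t.1 ∈ L)))) :
    ∀ s t : S, (clusterGraph S).Reachable s t ↔ Relation.EqvGen ρ s t := by
  have mono : ∀ (T : Set (ℤ × ℤ)) (hT : T ⊆ S) (x y : T), (clusterGraph T).Reachable x y →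
      (clusterGraph S).Reachable ⟨x.1, hT x.2⟩ ⟨y.1, hT y.2⟩ := by
    intro T hT x y h
    let f : clusterGraph T →g clusterGraph S :=
      { toFun := fun z => ⟨z.1, hT z.2⟩
        map_rel' := fun {_ _} hh => hh }
    exact h.map f
  have hLS : L ⊆ S := by subst hL; exact fun x hx => hx.1
  have hRS : R ⊆ S := by subst hR; exact fun x hx => hx.1
  have mem : ∀ s : S, s.1 ∈ L ∨ s.1 ∈ R := by
    intro s
    subst hL hR
    rcases lt_or_ge s.1.1 b with h | h
    · exact Or.inl ⟨s.2, h⟩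
    · exact Or.inr ⟨s.2, h⟩
  intro s t
  constructor
  · rintro ⟨w⟩
    induction w with
    | nil => exact Relation.EqvGen.refl _
    | @cons u v w hadj p ih =>
      refine Relation.EqvGen.trans _ _ _ (Relation.EqvGen.rel _ _ ?_) ih
      rw [hρ]
      have hadj' : TileAdj u.1 v.1 := hadj
      rcases mem u with hu | hu <;> rcases mem v with hv | hv
      · refine Or.inl ⟨hu, hv, SimpleGraph.Adj.reachable ?_⟩
        exact hadj'
      · exact Or.inr (Or.inr ⟨hadj', Or.inl ⟨hu, hv⟩⟩)
      · exact Or.inr (Or.inr ⟨hadj', Or.inr ⟨hu, hv⟩⟩)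
      · refine Or.inr (Or.inl ⟨hu, hv, SimpleGraph.Adj.reachable ?_⟩)
        exact hadj'
  · intro h
    induction h with
    | rel x y h =>
      rw [hρ] at h
      rcases h with ⟨hs, ht, h⟩ | ⟨hs, ht, h⟩ | ⟨h, -⟩
      · exact mono L hLS _ _ h
      · exact mono R hRS _ _ h
      · exact SimpleGraph.Adj.reachable (G := clusterGraph S) h
    | refl x => exact SimpleGraph.Reachable.refl _
    | symm x y _ ih => exact ih.symm
    | trans x y z _ _ ih1 ih2 => exact ih1.trans ih2
end

section
/- Let S be a set of tiles and f : ℤ × ℤ → ι a vertical slicing (f t depends only on the first coordinate t.1). Define the join relation ρ on S by: s ρ t iff (f s = f t and s and t are reachable in the cluster graph on S ∩ f⁻¹{f s}), or (f s ≠ f t and s and t are adjacent tiles). If the cluster graph on S is connected, i.e., S forms a single cluster, then every two tiles s, t ∈ S are related by the equivalence closure (EqvGen) of ρ; that is, joining the per-slice clusters along cross-slice adjacencies reconstructs the whole cluster regardless of how many slice borders it crosses. -/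
/-- **Theorem 2 (consecutive border crossings invariant).**
If the tiles of `S` form a single cluster, then joining the per-slice clusters
(for a vertical slicing `f`) along cross-slice adjacencies reconstructs the
whole cluster, regardless of how many slice borders it crosses. -/
theorem consecutive_border_crossings_invariant
    {ι : Type*} (S : Set (ℤ × ℤ)) (f : ℤ × ℤ → ι)
    (hf : ∃ g : ℤ → ι, ∀ t : ℤ × ℤ, f t = g t.1)
    (ρ : S → S → Prop)
    (hρ : ∀ s t : S, ρ s t ↔
      (f s.1 = f t.1 ∧
        ∃ (hs : s.1 ∈ S ∩ f ⁻¹' {f s.1}) (ht : t.1 ∈ S ∩ f ⁻¹' {f s.1}),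
          (clusterGraph (S ∩ f ⁻¹' {f s.1})).Reachable ⟨s.1, hs⟩ ⟨t.1, ht⟩) ∨
      (f s.1 ≠ f t.1 ∧ TileAdj s.1 t.1))
    (hconn : (clusterGraph S).Connected) :
    ∀ s t : S, Relation.EqvGen ρ s t := by
  intro s t
  obtain ⟨w⟩ := hconn.preconnected s t
  induction w with
  | nil => exact Relation.EqvGen.refl _
  | @cons a b c h _ ih =>
    refine Relation.EqvGen.trans _ b _ (Relation.EqvGen.rel _ _ ?_) ih
    rw [hρ]
    by_cases hab : f a.1 = f b.1
    · refine Or.inl ⟨hab, ⟨a.2, rfl⟩, ⟨b.2, hab.symm⟩, ?_⟩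
      apply SimpleGraph.Adj.reachable
      exact h
    · exact Or.inr ⟨hab, h⟩
end

section
/- Let S be a set of tiles. For any vertical slicing f : ℤ × ℤ → ι, define the join relation ρ_f on S by: s ρ_f t iff (f s = f t and s and t are reachable in the cluster graph on S ∩ f⁻¹{f s}), or (f s ≠ f t and s and t are adjacent tiles). Then for all s, t ∈ S, the pair (s, t) lies in the equivalence closure (EqvGen) of ρ_f if and only if s and t are in the same cluster of S. Consequently, for any two vertical slicings f₁ and f₂ (possibly into different slice index types and with different borders), the equivalence closures of ρ_{f₁} and ρ_{f₂} coincide on S: the clusters produced by per-slice clustering followed by joining across borders do not depend on the slicing in any way. -/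
/-- The join relation `ρ_f` on a set `S` of tiles, for a slicing `f`:
two tiles of `S` are related iff they lie in the same slice and are reachable
in the cluster graph of that slice, or they lie in different slices and are
adjacent tiles. -/
def joinRel {ι : Type*} (S : Set (ℤ × ℤ)) (f : ℤ × ℤ → ι) (s t : S) : Prop :=
  (f s.1 = f t.1 ∧
    ∃ (hs : s.1 ∈ S ∩ f ⁻¹' {f s.1}) (ht : t.1 ∈ S ∩ f ⁻¹' {f s.1}),
      (clusterGraph (S ∩ f ⁻¹' {f s.1})).Reachable ⟨s.1, hs⟩ ⟨t.1, ht⟩) ∨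
  (f s.1 ≠ f t.1 ∧ TileAdj s.1 t.1)

theorem eqvGen_joinRel_iff {ι : Type*} (S : Set (ℤ × ℤ)) (f : ℤ × ℤ → ι) (s t : S) :
    Relation.EqvGen (joinRel S f) s t ↔ (clusterGraph S).Reachable s t := by
  constructor
  · intro h
    induction h with
    | rel x y h =>
      rcases h with ⟨-, hs, ht, h⟩ | ⟨-, h⟩
      · let φ : clusterGraph (S ∩ f ⁻¹' {f x.1}) →g clusterGraph S :=
          { toFun := fun a => ⟨a.1, a.2.1⟩
            map_rel' := fun {a b} hab => hab }
        exact h.map φ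
      · exact SimpleGraph.Adj.reachable (G := clusterGraph S) h
    | refl x => exact SimpleGraph.Reachable.refl x
    | symm x y _ ih => exact ih.symm
    | trans x y z _ _ ih1 ih2 => exact ih1.trans ih2
  · rintro ⟨w⟩
    induction w with
    | nil => exact Relation.EqvGen.refl _
    | @cons a b c h w ih =>
      refine Relation.EqvGen.trans _ _ _ (Relation.EqvGen.rel _ _ ?_) ih
      by_cases hf : f a.1 = f b.1
      · refine Or.inl ⟨hf, ⟨a.2, rfl⟩, ⟨b.2, hf.symm⟩, ?_⟩
        exact SimpleGraph.Adj.reachable (G := clusterGraph (S ∩ f ⁻¹' {f a.1})) h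
      · exact Or.inr ⟨hf, h⟩

/-- **Theorem 3 (arbitrary slicing invariant).**
For any vertical slicing `f`, the equivalence closure of the join relation
`ρ_f` relates two tiles of `S` iff they lie in the same cluster of `S`.
Consequently, for any two vertical slicings `f₁` and `f₂` the equivalence
closures of `ρ_{f₁}` and `ρ_{f₂}` coincide on `S`: the clusters produced by
per-slice clustering followed by joining across borders do not depend on the
slicing in any way. -/
theorem arbitrary_slicing_invariant (S : Set (ℤ × ℤ)) :
    (∀ {ι : Type} (f : ℤ × ℤ → ι), (∃ g : ℤ → ι, ∀ t : ℤ × ℤ, f t = g t.1) →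
      ∀ s t : S, Relation.EqvGen (joinRel S f) s t ↔
        (clusterGraph S).Reachable s t) ∧
    (∀ {ι₁ ι₂ : Type} (f₁ : ℤ × ℤ → ι₁) (f₂ : ℤ × ℤ → ι₂),
      (∃ g₁ : ℤ → ι₁, ∀ t : ℤ × ℤ, f₁ t = g₁ t.1) →
      (∃ g₂ : ℤ → ι₂, ∀ t : ℤ × ℤ, f₂ t = g₂ t.1) →
      ∀ s t : S, Relation.EqvGen (joinRel S f₁) s t ↔
        Relation.EqvGen (joinRel S f₂) s t) := by
  exact ⟨fun f _ s t => eqvGen_joinRel_iff S f s t, fun f₁ f₂ _ _ s t =>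
    (eqvGen_joinRel_iff S f₁ s t).trans (eqvGen_joinRel_iff S f₂ s t).symm⟩
end

section
/- Let G be a simple graph on a vertex type V and let f : V → ι be any function assigning a slice index to each vertex. Define the relation R on V by: R u v iff (f u = f v and u and v are reachable in the subgraph of G induced on the set {w | f w = f u}), or (f u ≠ f v and u is adjacent to v in G). Then for all u, v : V, the equivalence closure (EqvGen) of R relates u and v if and only if u and v are reachable in G. In particular, the connected components of G are exactly the equivalence classes obtained by joining the connected components of the induced subgraphs on the slices along edges between distinct slices. -/
/-- **General joining lemma.**
For a simple graph `G` on `V` and any slicing function `f : V → ι`, the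
equivalence closure of the relation "same slice and reachable in the induced
subgraph on that slice, or different slices and adjacent in `G`" relates two
vertices iff they are reachable in `G`.  In particular, the connected
components of `G` are exactly the equivalence classes obtained by joining the
connected components of the induced subgraphs on the slices along edges
between distinct slices. -/
theorem eqvGen_slice_join_iff_reachable
    {V : Type*} {ι : Type*} (G : SimpleGraph V) (f : V → ι)
    (R : V → V → Prop)
    (hR : ∀ u v : V, R u v ↔
      ((∃ h : f u = f v,
          (G.induce {w : V | f w = f u}).Reachable ⟨u, rfl⟩ ⟨v, h.symm⟩) ∨
        (f u ≠ f v ∧ G.Adj u v))) :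
    ∀ u v : V, Relation.EqvGen R u v ↔ G.Reachable u v := by
  intro u v
  constructor
  · intro h
    induction h with
    | rel x y hxy =>
      rcases (hR x y).1 hxy with ⟨h, hr⟩ | ⟨_, ha⟩
      · exact hr.map (SimpleGraph.Embedding.induce {w : V | f w = f x}).toHom
      · exact ha.reachable
    | refl x => exact SimpleGraph.Reachable.refl x
    | symm x y _ ih => exact ih.symm
    | trans x y z _ _ ih1 ih2 => exact ih1.trans ih2
  · rintro ⟨p⟩
    induction p with
    | nil => exact Relation.EqvGen.refl _
    | @cons a b c hab _ ih =>
      refine Relation.EqvGen.trans _ _ _ (Relation.EqvGen.rel _ _ ((hR a b).2 ?_)) ih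
      by_cases h : f a = f b
      · refine Or.inl ⟨h, SimpleGraph.Adj.reachable ?_⟩
        exact hab
      · exact Or.inr ⟨h, hab⟩
end

section
/- Let S be a set of tiles, let a < b be integers, and let V = {t ∈ ℤ × ℤ | a ≤ t.1 ∧ t.1 < b} be a vertical slice. Suppose C is a cluster (connected component) of the cluster graph on S ∩ V such that no tile of C touches a border column of the slice, i.e., every t ∈ C satisfies a < t.1 and t.1 < b − 1. Then C is also a cluster of the cluster graph on the full set S: for every s ∈ C and every t ∈ S, s and t are in the same cluster of S if and only if t ∈ C. -/
/-- A cluster of a vertical slice `V = {t | a ≤ t.1 < b}` that does not touch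
a border column of the slice is also a cluster of the full set `S`:
it can be output directly, without any joining step. -/
theorem interior_slice_cluster_is_global_cluster
    (S : Set (ℤ × ℤ)) (a b : ℤ) (hab : a < b)
    (V : Set (ℤ × ℤ)) (hV : V = {t : ℤ × ℤ | a ≤ t.1 ∧ t.1 < b})
    (C : Set (ℤ × ℤ))
    (hC : ∃ (s₀ : ℤ × ℤ) (hs₀ : s₀ ∈ S ∩ V),
      C = {t : ℤ × ℤ | ∃ ht : t ∈ S ∩ V,
        (clusterGraph (S ∩ V)).Reachable ⟨s₀, hs₀⟩ ⟨t, ht⟩})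
    (hborder : ∀ t ∈ C, a < t.1 ∧ t.1 < b - 1) :
    ∀ s ∈ C, ∀ t ∈ S,
      ((∃ (hs : s ∈ S) (ht : t ∈ S),
          (clusterGraph S).Reachable ⟨s, hs⟩ ⟨t, ht⟩) ↔ t ∈ C) := by
  obtain ⟨s₀, hs₀, hCe⟩ := hC
  have step : ∀ x ∈ C, ∀ y ∈ S, TileAdj x y → y ∈ C := by
    intro x hx y hy hxy
    have hb := hborder x hx
    have hyV : y ∈ V := by
      have h1 := abs_le.mp ((le_max_left _ _).trans hxy.2)
      rw [hV]
      constructor <;> linarith [h1.1, h1.2, hb.1, hb.2]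
    rw [hCe] at hx ⊢
    obtain ⟨hx', hr⟩ := hx
    refine ⟨⟨hy, hyV⟩, hr.trans (SimpleGraph.Adj.reachable ?_)⟩
    exact hxy
  intro s hs t ht
  constructor
  · rintro ⟨hs', ht', ⟨w⟩⟩
    have key : ∀ (u v : S), (clusterGraph S).Walk u v → u.1 ∈ C → v.1 ∈ C := by
      intro u v w
      induction w with
      | nil => exact id
      | cons h _ ih => exact fun hu => ih (step _ hu _ (Subtype.property _) h)
    exact key _ _ w hs
  · intro htC
    rw [hCe] at hs htC
    obtain ⟨hs', hrs⟩ := hs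
    obtain ⟨ht', hrt⟩ := htC
    let f : clusterGraph (S ∩ V) →g clusterGraph S :=
      { toFun := fun x => ⟨x.1, x.2.1⟩
        map_rel' := fun h => h }
    exact ⟨hs'.1, ht, (hrs.symm.trans hrt).map f⟩
end

section
/- Let S be a set of tiles and b ∈ ℤ. If s, t ∈ S lie in the same cluster of S and s.1 < b ≤ t.1 (the cluster crosses the border b), then there exist tiles u, v ∈ S, both in the same cluster of S as s, such that u and v are adjacent, u.1 = b − 1, and v.1 = b. -/
theorem walk_crossing (S : Set (ℤ × ℤ)) (b : ℤ) {x y : S} (p : (clusterGraph S).Walk x y)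
    (hx : x.1.1 < b) (hy : b ≤ y.1.1) :
    ∃ u v : S, (clusterGraph S).Reachable x u ∧ (clusterGraph S).Adj u v ∧
      u.1.1 < b ∧ b ≤ v.1.1 := by
  induction p with
  | nil => omega
  | @cons x z y h p ih =>
    by_cases hz : z.1.1 < b
    · obtain ⟨u, v, h1, h2⟩ := ih hz hy
      exact ⟨u, v, h.reachable.trans h1, h2⟩
    · exact ⟨x, z, SimpleGraph.Reachable.refl _, h, hx, not_lt.mp hz⟩

/-- A cluster crossing the column border `b` must contain an adjacent pair of
tiles in columns `b - 1` and `b`. -/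
theorem cluster_crossing_border_has_adjacent_pair
    (S : Set (ℤ × ℤ)) (b : ℤ) (s t : ℤ × ℤ)
    (hs : s ∈ S) (ht : t ∈ S)
    (hreach : (clusterGraph S).Reachable ⟨s, hs⟩ ⟨t, ht⟩)
    (hsb : s.1 < b) (htb : b ≤ t.1) :
    ∃ (u v : ℤ × ℤ) (hu : u ∈ S) (hv : v ∈ S),
      (clusterGraph S).Reachable ⟨s, hs⟩ ⟨u, hu⟩ ∧
      (clusterGraph S).Reachable ⟨s, hs⟩ ⟨v, hv⟩ ∧
      TileAdj u v ∧ u.1 = b - 1 ∧ v.1 = b := by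
  obtain ⟨p⟩ := hreach
  obtain ⟨u, v, h1, h2, h3, h4⟩ := walk_crossing S b p hsb htb
  have h5 : TileAdj u.1 v.1 := h2
  have h6 := abs_le.mp ((le_max_left _ _).trans h5.2)
  exact ⟨u.1, v.1, u.2, v.2, h1, h1.trans h2.reachable, h5, by omega, by omega⟩
end

section
/- For every offset o ∈ ℝ × ℝ and every ε > 0, there exist four pairwise distinct points p₁, p₂, p₃, p₄ ∈ ℝ × ℝ whose pairwise Euclidean distances are all less than ε, and whose projections to the grid shifted by o, namely the tiles (⌊pᵢ.1 − o.1⌋, ⌊pᵢ.2 − o.2⌋) ∈ ℤ × ℤ for i = 1, …, 4, are pairwise distinct. Consequently, with significance threshold τ = 4, no tile of the shifted grid contains all four points, for any shift o of the grid. -/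
/-- Euclidean distance between two points of `ℝ × ℝ`. -/
noncomputable def euclDist (p q : ℝ × ℝ) : ℝ :=
  Real.sqrt ((p.1 - q.1) ^ 2 + (p.2 - q.2) ^ 2)

/-- Projection of a point to the unit grid shifted by the offset `o`. -/
noncomputable def gridProj (o p : ℝ × ℝ) : ℤ × ℤ :=
  (⌊p.1 - o.1⌋, ⌊p.2 - o.2⌋)

/-- **Grid placement corner case (Fig. 4 of the paper).**
For any shift `o` of the grid and any `ε > 0`, there are four pairwise
distinct points within Euclidean distance `ε` of each other whose projections
to the grid shifted by `o` are pairwise distinct.  Consequently, with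
significance threshold `τ = 4`, no tile of the shifted grid contains all four
points, for any shift of the grid. -/
theorem four_close_points_on_distinct_tiles (o : ℝ × ℝ) (ε : ℝ) (hε : 0 < ε) :
    ∃ p₁ p₂ p₃ p₄ : ℝ × ℝ,
      (p₁ ≠ p₂ ∧ p₁ ≠ p₃ ∧ p₁ ≠ p₄ ∧ p₂ ≠ p₃ ∧ p₂ ≠ p₄ ∧ p₃ ≠ p₄) ∧
      (euclDist p₁ p₂ < ε ∧ euclDist p₁ p₃ < ε ∧ euclDist p₁ p₄ < ε ∧
        euclDist p₂ p₃ < ε ∧ euclDist p₂ p₄ < ε ∧ euclDist p₃ p₄ < ε) ∧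
      (gridProj o p₁ ≠ gridProj o p₂ ∧ gridProj o p₁ ≠ gridProj o p₃ ∧
        gridProj o p₁ ≠ gridProj o p₄ ∧ gridProj o p₂ ≠ gridProj o p₃ ∧
        gridProj o p₂ ≠ gridProj o p₄ ∧ gridProj o p₃ ≠ gridProj o p₄) ∧
      ¬ ∃ q : ℤ × ℤ, gridProj o p₁ = q ∧ gridProj o p₂ = q ∧
        gridProj o p₃ = q ∧ gridProj o p₄ = q := by
  obtain ⟨d, hd0, hd1, hdε⟩ : ∃ d : ℝ, 0 < d ∧ d < 1 ∧ d < ε / 2 := by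
    refine ⟨min (1 / 2) (ε / 4), by positivity, ?_, ?_⟩
    · exact lt_of_le_of_lt (min_le_left _ _) (by norm_num)
    · exact lt_of_le_of_lt (min_le_right _ _) (by linarith)
  have h0 : ∀ a : ℝ, ⌊a - a⌋ = 0 := by intro a; simp
  have h1 : ∀ a : ℝ, ⌊a - d - a⌋ = -1 := by
    intro a
    rw [Int.floor_eq_iff]
    push_cast
    constructor <;> linarith
  have g1 : gridProj o (o.1, o.2) = (0, 0) := by simp only [gridProj, h0]
  have g2 : gridProj o (o.1 - d, o.2) = (-1, 0) := by simp only [gridProj, h0, h1]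
  have g3 : gridProj o (o.1, o.2 - d) = (0, -1) := by simp only [gridProj, h0, h1]
  have g4 : gridProj o (o.1 - d, o.2 - d) = (-1, -1) := by simp only [gridProj, h1]
  have hD : ∀ p q : ℝ × ℝ, (p.1 - q.1) ^ 2 ≤ d ^ 2 → (p.2 - q.2) ^ 2 ≤ d ^ 2 →
      euclDist p q < ε := by
    intro p q h h'
    rw [euclDist, Real.sqrt_lt' hε]
    nlinarith
  have key : ∀ p q : ℝ × ℝ, gridProj o p ≠ gridProj o q → p ≠ q :=
    fun p q h e => h (by rw [e])
  refine ⟨(o.1, o.2), (o.1 - d, o.2), (o.1, o.2 - d), (o.1 - d, o.2 - d), ?_, ?_, ?_, ?_⟩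
  · refine ⟨?_, ?_, ?_, ?_, ?_, ?_⟩ <;> apply key <;> simp only [g1, g2, g3, g4] <;> decide
  · refine ⟨?_, ?_, ?_, ?_, ?_, ?_⟩ <;> apply hD <;> dsimp only <;> nlinarith [sq_nonneg d]
  · simp only [g1, g2, g3, g4]; decide
  · rintro ⟨q, a, b, -, -⟩
    rw [g1] at a
    rw [g2, ← a] at b
    exact absurd b (by decide)
end
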